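/- Let f be a horizontal extension of an irrational rotation of 𝕋² with horizontal map h, and let f̂ : 𝔸 → 𝔸 be a lift of f. Then there exists B > 0 such that for every interval I ⊂ S¹ and every connected component A ⊂ 𝔸 of θ⁻¹(h⁻¹(I)), one has diam(pr₂(f̂ⁿ(A))) ≤ B for all n ∈ ℤ. -/

import Mathlib

/- STATEMENT 8: For a horizontal extension `f` of an irrational rotation with
lift `f̂ : 𝔸 → 𝔸`, there is `B > 0` such that for every interval `I ⊆ S¹` and
every connected component `A` of `θ⁻¹(h⁻¹(I))`, the vertical diameter
`diam(pr₂(f̂ⁿ(A)))` is at most `B` for all `n ∈ ℤ`.  An interval of `S¹` is the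
image of an order-connected subset of `ℝ`; negative iterates are expressed via
the inverse `ĝ` of `f̂`. -/

noncomputable section
open Set Metric Filter Topology Function

abbrev 𝕊 : Type := AddCircle (1:ℝ)
abbrev 𝔸 : Type := 𝕊 × ℝ
abbrev 𝕋2 : Type := 𝕊 × 𝕊

def τ : ℝ × ℝ → 𝔸 := fun p => ((p.1 : 𝕊), p.2)
def θ : 𝔸 → 𝕋2 := fun p => (p.1, (p.2 : 𝕊))

/-- The connected components of a set `S ⊆ 𝔸`. -/
def comps (S : Set 𝔸) : Set (Set 𝔸) := {C | ∃ z ∈ S, C = connectedComponentIn S z}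

/-- A subset of the annulus is unbounded above. -/
def UnbAbove (C : Set 𝔸) : Prop := ¬ BddAbove (Prod.snd '' C)
/-- A subset of the annulus is unbounded below. -/
def UnbBelow (C : Set 𝔸) : Prop := ¬ BddBelow (Prod.snd '' C)

/-- An essential continuum: a compact connected set whose complement has exactly two
unbounded connected components, one unbounded above, the other unbounded below. -/
def IsEssentialContinuum (E : Set 𝔸) : Prop :=
  IsCompact E ∧ IsConnected E ∧
  ∃ U V : Set 𝔸, U ∈ comps Eᶜ ∧ V ∈ comps Eᶜ ∧ U ≠ V ∧
    UnbAbove U ∧ ¬ UnbBelow U ∧ UnbBelow V ∧ ¬ UnbAbove V ∧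
    ∀ C ∈ comps Eᶜ, ¬ Bornology.IsBounded C → C = U ∨ C = V

/-- The lower unbounded complementary region `U⁻(E)` of an essential continuum. -/
def Uminus (E : Set 𝔸) : Set 𝔸 :=
  {z | z ∉ E ∧ UnbBelow (connectedComponentIn Eᶜ z)}

/-- The partial order `C₁ ≺ C₂` on essential continua. -/
def Prec (C₁ C₂ : Set 𝔸) : Prop := C₁ ⊆ Uminus C₂

/-- An essential annular continuum: a compact connected set whose complement has
exactly two connected components, both unbounded. -/
def IsEssentialAnnularContinuum (E : Set 𝔸) : Prop :=
  IsCompact E ∧ IsConnected E ∧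
  ∃ U V : Set 𝔸, U ∈ comps Eᶜ ∧ V ∈ comps Eᶜ ∧ U ≠ V ∧
    UnbAbove U ∧ UnbBelow V ∧ ∀ C ∈ comps Eᶜ, C = U ∨ C = V

/-- The infimum distance between two subsets of the annulus. -/
def setDist (s t : Set 𝔸) : ℝ := sInf {r | ∃ x ∈ s, ∃ y ∈ t, r = dist x y}

/-- The upper width of `A ⊆ 𝔸`. -/
def uw (A : Set 𝔸) : ℝ :=
  sSup {r | ∃ C₁ C₂ : Set 𝔸, IsEssentialContinuum C₁ ∧ IsEssentialContinuum C₂ ∧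
    C₁ ⊆ A ∧ C₂ ⊆ A ∧ r = hausdorffDist C₁ C₂}

/-- The lower width of `A ⊆ 𝔸`. -/
def lw (A : Set 𝔸) : ℝ :=
  sSup {r | ∃ C₁ C₂ : Set 𝔸, IsEssentialContinuum C₁ ∧ IsEssentialContinuum C₂ ∧
    C₁ ⊆ A ∧ C₂ ⊆ A ∧ r = setDist C₁ C₂}

/-- A horizontal annular continuum in the torus. -/
def IsHorizontalAnnularContinuum (C : Set 𝕋2) : Prop :=
  IsCompact C ∧ IsConnected C ∧
  ∀ z ∈ θ ⁻¹' C, IsEssentialAnnularContinuum (connectedComponentIn (θ ⁻¹' C) z)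

/-- A horizontal map `h : 𝕋² → S¹`. -/
def IsHorizontalMap (h : 𝕋2 → 𝕊) : Prop :=
  Continuous h ∧ Function.Surjective h ∧ ∀ t : 𝕊, IsHorizontalAnnularContinuum (h ⁻¹' {t})

/-- The lower density of a set of natural numbers. -/
def lowerDensity (G : Set ℕ) : ℝ :=
  liminf (fun n : ℕ => ((G ∩ Set.Icc 1 n).ncard : ℝ) / n) atTop

/-- An essential simple loop, regarded as a subset of the annulus. -/
def IsEssentialSimpleLoop (Γ : Set 𝔸) : Prop :=
  (∃ γ : 𝕊 → 𝔸, Continuous γ ∧ Function.Injective γ ∧ Γ = Set.range γ) ∧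
  IsEssentialContinuum Γ

/-- A closed essential topological annulus: a homeomorphic copy of `S¹ × [0,1]`
containing an essential loop. -/
def IsClosedEssentialAnnulus (A : Set 𝔸) : Prop :=
  (∃ φ : 𝕊 × (Set.Icc (0:ℝ) 1) → 𝔸, Continuous φ ∧ Function.Injective φ ∧ A = Set.range φ) ∧
  ∃ Γ ⊆ A, IsEssentialSimpleLoop Γ

/-- Two lifts to `ℝ` of the same circle-valued function differ by a constant on a preconnected
set. -/
theorem sub_eq_sub_of_coe_eq {X : Type*} [TopologicalSpace X] {S : Set X} (hS : IsPreconnected S)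
    {g g' : X → ℝ} (hg : ContinuousOn g S) (hg' : ContinuousOn g' S)
    (hgg' : ∀ x ∈ S, (g x : 𝕊) = g' x) {x y : X} (hx : x ∈ S) (hy : y ∈ S) :
    g x - g' x = g y - g' y := by
  refine hS.constant_of_mapsTo (T := range ((↑) : ℤ → ℝ))
    Int.isClosedEmbedding_coe_real.isEmbedding.isDiscrete_range (hg.sub hg') ?_ hx hy
  intro z hz
  obtain ⟨n, hn⟩ := AddCircle.coe_eq_zero_iff (p := (1 : ℝ)) |>.1
    (show ((g z - g' z : ℝ) : 𝕊) = 0 by rw [AddCircle.coe_sub, hgg' z hz, sub_self])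
  exact ⟨n, by simpa using hn⟩

theorem exists_real_lift {φ : ℝ × ℝ → 𝕊} (hφ : Continuous φ) :
    ∃ F : ℝ × ℝ → ℝ, Continuous F ∧ ∀ p, (F p : 𝕊) = φ p := by
  obtain ⟨e, he⟩ := QuotientAddGroup.mk_surjective (φ 0)
  obtain ⟨F, ⟨-, hF⟩, -⟩ := (AddCircle.isCoveringMap_coe (1 : ℝ)).existsUnique_continuousMap_lifts
    ⟨φ, hφ⟩ 0 e he
  exact ⟨F, F.continuous, fun p => congrFun hF p⟩

theorem isOpenQuotientMap_coe_circle : IsOpenQuotientMap ((↑) : ℝ → 𝕊) :=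
  QuotientAddGroup.isOpenQuotientMap_mk

theorem isOpenQuotientMap_τ : IsOpenQuotientMap τ :=
  isOpenQuotientMap_coe_circle.prodMap .id

theorem isOpenQuotientMap_θ : IsOpenQuotientMap θ :=
  IsOpenQuotientMap.id.prodMap isOpenQuotientMap_coe_circle

theorem τ_add_one (x y : ℝ) : τ (x + 1, y) = τ (x, y) := by
  simp [τ]

theorem θ_add_one (x : 𝕊) (y : ℝ) : θ (x, y + 1) = θ (x, y) := by
  simp [θ]

theorem connectedSpace_annulus : ConnectedSpace 𝔸 :=
  isOpenQuotientMap_τ.surjective.connectedSpace isOpenQuotientMap_τ.continuous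

theorem locallyConnectedSpace_annulus : LocallyConnectedSpace 𝔸 :=
  isOpenQuotientMap_τ.isQuotientMap.locallyConnectedSpace

/-- The horizontal degree of a lift does not depend on the point at which it is computed. -/
theorem horizontal_sub_const {φ : 𝔸 → 𝕊} {F : ℝ × ℝ → ℝ} (hF : Continuous F)
    (hFφ : ∀ p, (F p : 𝕊) = φ (τ p)) (x y x' y' : ℝ) :
    F (x + 1, y) - F (x, y) = F (x' + 1, y') - F (x', y') :=
  sub_eq_sub_of_coe_eq (g := fun p : ℝ × ℝ => F (p.1 + 1, p.2)) (g' := F) isPreconnected_univ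
    (by fun_prop) (by fun_prop) (fun p _ => by rw [hFφ, hFφ, τ_add_one])
    (mem_univ (x, y)) (mem_univ (x', y'))

theorem comps_subset {S C : Set 𝔸} (hC : C ∈ comps S) : C ⊆ S := by
  obtain ⟨z, -, rfl⟩ := hC
  exact connectedComponentIn_subset S z

theorem eq_connectedComponentIn_of_mem_comps {S C : Set 𝔸} (hC : C ∈ comps S) {w : 𝔸}
    (hw : w ∈ C) : C = connectedComponentIn S w := by
  obtain ⟨z, -, rfl⟩ := hC
  exact connectedComponentIn_eq hw

theorem isPreconnected_univ_circle : IsPreconnected (univ : Set 𝕊) := by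
  rw [← isOpenQuotientMap_coe_circle.surjective.range_eq]
  exact isPreconnected_range isOpenQuotientMap_coe_circle.continuous

theorem exists_circle_subset_of_unbAbove {E U : Set 𝔸} (hE : IsCompact E) (hU : U ∈ comps Eᶜ)
    (hUa : UnbAbove U) : ∃ y : ℝ, ∀ x : 𝕊, (x, y) ∈ U := by
  obtain ⟨R, hR⟩ := (hE.image continuous_snd).bddAbove
  obtain ⟨-, ⟨w, hw, rfl⟩, hwR⟩ := not_bddAbove_iff.1 hUa R
  refine ⟨w.2, fun x => ?_⟩
  rw [eq_connectedComponentIn_of_mem_comps hU hw]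
  refine (isPreconnected_univ_circle.prod isPreconnected_Ioi).subset_connectedComponentIn
    (s := univ ×ˢ Ioi R) ⟨mem_univ _, hwR⟩ ?_ ⟨mem_univ _, hwR⟩
  exact fun z hz hzE => (hR (mem_image_of_mem _ hzE)).not_gt hz.2

theorem exists_circle_subset_of_unbBelow {E U : Set 𝔸} (hE : IsCompact E) (hU : U ∈ comps Eᶜ)
    (hUb : UnbBelow U) : ∃ y : ℝ, ∀ x : 𝕊, (x, y) ∈ U := by
  obtain ⟨R, hR⟩ := (hE.image continuous_snd).bddBelow
  obtain ⟨-, ⟨w, hw, rfl⟩, hwR⟩ := not_bddBelow_iff.1 hUb R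
  refine ⟨w.2, fun x => ?_⟩
  rw [eq_connectedComponentIn_of_mem_comps hU hw]
  refine (isPreconnected_univ_circle.prod isPreconnected_Iio).subset_connectedComponentIn
    (s := univ ×ˢ Iio R) ⟨mem_univ _, hwR⟩ ?_ ⟨mem_univ _, hwR⟩
  exact fun z hz hzE => (hR (mem_image_of_mem _ hzE)).not_gt hz.2

/-- A circle-valued map on the annulus which is constant on an essential annular continuum has
horizontal degree zero: replacing it by that constant above the continuum yields a continuous map
that is constant on high horizontal circles and agrees with the given one on low circles. -/
theorem horizontal_periodic_of_const_on_essential {E : Set 𝔸}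
    (hE : IsEssentialAnnularContinuum E) {φ : 𝔸 → 𝕊} (hφ : Continuous φ) {c : ℝ}
    (hc : ∀ z ∈ E, φ z = c) {F : ℝ × ℝ → ℝ} (hF : Continuous F)
    (hFφ : ∀ p, (F p : 𝕊) = φ (τ p)) (x y : ℝ) : F (x + 1, y) = F (x, y) := by
  classical
  have := locallyConnectedSpace_annulus
  obtain ⟨hEc, -, U, V, hU, hV, hUV, hUa, hVb, hall⟩ := hE
  have hopen : ∀ W ∈ comps Eᶜ, IsOpen W := by
    rintro W ⟨w, -, rfl⟩
    exact hEc.isClosed.isOpen_compl.connectedComponentIn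
  have hdisj : Disjoint U V := by
    rw [disjoint_left]
    intro w hwU hwV
    exact hUV ((eq_connectedComponentIn_of_mem_comps hU hwU).trans
      (eq_connectedComponentIn_of_mem_comps hV hwV).symm)
  have hfront : frontier U ⊆ E := by
    intro w hw
    by_contra hwE
    rw [(hopen U hU).frontier_eq] at hw
    have hmem : w ∈ connectedComponentIn Eᶜ w := mem_connectedComponentIn hwE
    rcases hall _ ⟨w, hwE, rfl⟩ with h1 | h1
    · exact hw.2 (h1 ▸ hmem)
    · exact disjoint_left.1 (hdisj.closure_left (hopen V hV)) hw.1 (h1 ▸ hmem)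
  let r : 𝔸 → 𝕊 := fun z => if z ∈ U then (c : 𝕊) else φ z
  have hr : Continuous r :=
    Continuous.if (fun a ha => (hc a (hfront ha)).symm) continuous_const hφ
  obtain ⟨G, hG, hGr⟩ := exists_real_lift (hr.comp isOpenQuotientMap_τ.continuous)
  obtain ⟨yU, hyU⟩ := exists_circle_subset_of_unbAbove hEc hU hUa
  obtain ⟨yV, hyV⟩ := exists_circle_subset_of_unbBelow hEc hV hVb
  have htop : G (0 + 1, yU) = G (0, yU) := by
    have := sub_eq_sub_of_coe_eq (g := fun x => G (x, yU)) (g' := fun _ => c)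
      isPreconnected_univ (by fun_prop) (by fun_prop)
      (fun x _ => by rw [hGr]; exact if_pos (hyU x)) (mem_univ (0 + 1)) (mem_univ 0)
    simpa using this
  have hbot : G (0 + 1, yV) - F (0 + 1, yV) = G (0, yV) - F (0, yV) :=
    sub_eq_sub_of_coe_eq (g := fun x => G (x, yV)) (g' := fun x => F (x, yV))
      isPreconnected_univ (by fun_prop) (by fun_prop)
      (fun x _ => by
        rw [hGr, hFφ]
        exact if_neg fun hx => disjoint_left.1 hdisj hx (hyV x))
      (mem_univ (0 + 1)) (mem_univ 0)
  have hG' := horizontal_sub_const hG hGr 0 yU 0 yV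
  have hF' := horizontal_sub_const hF hFφ x y 0 yV
  linarith

theorem exists_descent_τ {F : ℝ × ℝ → ℝ} (hF : Continuous F)
    (hper : ∀ x y, F (x + 1, y) = F (x, y)) : ∃ H : 𝔸 → ℝ, Continuous H ∧ ∀ p, H (τ p) = F p := by
  have hp : ∀ y, Function.Periodic (fun x => F (x, y)) 1 := fun y x => hper x y
  refine ⟨fun z => (hp z.2).lift z.1, ?_, fun p => (hp p.2).lift_coe p.1⟩
  rw [isOpenQuotientMap_τ.isQuotientMap.continuous_iff]
  exact hF.congr fun p => ((hp p.2).lift_coe p.1).symm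

theorem exists_descent_θ {H : 𝔸 → ℝ} (hH : Continuous H)
    (hper : ∀ x y, H (x, y + 1) = H (x, y)) : ∃ K : 𝕋2 → ℝ, Continuous K ∧ ∀ p, K (θ p) = H p := by
  have hp : ∀ x, Function.Periodic (fun y => H (x, y)) 1 := fun x y => hper x y
  refine ⟨fun z => (hp z.1).lift z.2, ?_, fun p => (hp p.1).lift_coe p.2⟩
  rw [isOpenQuotientMap_θ.isQuotientMap.continuous_iff]
  exact hH.congr fun p => ((hp p.1).lift_coe p.2).symm

/-- A continuous real function on the torus cannot lift a surjection onto the circle with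
connected fibres. -/
theorem not_exists_lift_of_connected_fibres {h : 𝕋2 → 𝕊} (hsurj : Function.Surjective h)
    (hfib : ∀ t, IsPreconnected (h ⁻¹' {t})) {K : 𝕋2 → ℝ} (hK : Continuous K)
    (hKh : ∀ p, (K p : 𝕊) = h p) : False := by
  have hinj : ∀ p q, h p = h q → K p = K q := by
    intro p q hpq
    obtain ⟨c, hc⟩ := QuotientAddGroup.mk_surjective (h q)
    have := sub_eq_sub_of_coe_eq (g := K) (g' := fun _ => c) (hfib (h q)) hK.continuousOn
      continuousOn_const (fun x hx => by rw [hKh, hx]; exact hc.symm) (show p ∈ _ from hpq)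
      (show q ∈ _ from rfl)
    simpa using this
  have : ConnectedSpace 𝔸 := connectedSpace_annulus
  have : ConnectedSpace 𝕋2 :=
    isOpenQuotientMap_θ.surjective.connectedSpace isOpenQuotientMap_θ.continuous
  obtain ⟨p, -, hp⟩ := isCompact_univ.exists_isMinOn (univ_nonempty (α := 𝕋2)) hK.continuousOn
  obtain ⟨q, -, hq⟩ := isCompact_univ.exists_isMaxOn (univ_nonempty (α := 𝕋2)) hK.continuousOn
  have hp' : ∀ z, K p ≤ K z := fun z => hp (mem_univ z)
  have hq' : ∀ z, K z ≤ K q := fun z => hq (mem_univ z)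
  by_cases hlen : K p + 1 ≤ K q
  · obtain ⟨w, hw⟩ := mem_range_of_exists_le_of_exists_ge hK ⟨p, by linarith⟩ ⟨q, hlen⟩
    have := hinj w p (by rw [← hKh, ← hKh, hw]; simp)
    linarith
  · push Not at hlen
    obtain ⟨w, hw⟩ := hsurj (((K q + K p + 1) / 2 : ℝ) : 𝕊)
    rw [← hKh, AddCircle.coe_eq_coe_iff_of_mem_Ico (a := K p) ⟨hp' w, by linarith [hq' w]⟩
      ⟨by linarith [hp' q], by linarith⟩] at hw
    linarith [hq' w]

/-- A horizontal map lifts to a real function on the annulus whose vertical degree is a nonzero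
integer. -/
theorem IsHorizontalMap.exists_lift {h : 𝕋2 → 𝕊} (hh : IsHorizontalMap h) :
    ∃ (H : 𝔸 → ℝ) (d : ℤ), Continuous H ∧ (∀ z, (H z : 𝕊) = h (θ z)) ∧ d ≠ 0 ∧
      ∀ x y, H (x, y + 1) = H (x, y) + d := by
  have := connectedSpace_annulus
  obtain ⟨hcont, hsurj, hfib⟩ := hh
  have hφ : Continuous (h ∘ θ) := hcont.comp isOpenQuotientMap_θ.continuous
  obtain ⟨F, hF, hFφ⟩ := exists_real_lift (hφ.comp isOpenQuotientMap_τ.continuous)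
  obtain ⟨z, hz⟩ := (hsurj.comp isOpenQuotientMap_θ.surjective) ((0 : ℝ) : 𝕊)
  have hper := horizontal_periodic_of_const_on_essential ((hfib ((0 : ℝ) : 𝕊)).2.2 z hz) hφ
    (fun w hw => connectedComponentIn_subset (θ ⁻¹' (h ⁻¹' {((0 : ℝ) : 𝕊)})) z hw) hF hFφ
  obtain ⟨H, hH, hHF⟩ := exists_descent_τ hF hper
  have hHφ : ∀ z, (H z : 𝕊) = h (θ z) := by
    intro z
    obtain ⟨p, rfl⟩ := isOpenQuotientMap_τ.surjective z
    rw [hHF, hFφ]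
    rfl
  have hcoe : ∀ z : 𝔸, (H (z.1, z.2 + 1) : 𝕊) = H z := fun z => by rw [hHφ, hHφ, θ_add_one]
  obtain ⟨d, hd⟩ := (AddCircle.coe_eq_zero_iff (1 : ℝ)).1
    (show ((H (0, 0 + 1) - H (0, 0) : ℝ) : 𝕊) = 0 by
      rw [AddCircle.coe_sub, hcoe (0, 0), sub_self])
  have hstep : ∀ x y, H (x, y + 1) = H (x, y) + d := by
    intro x y
    have := sub_eq_sub_of_coe_eq (g := fun z : 𝔸 => H (z.1, z.2 + 1)) (g' := H)
      isPreconnected_univ (by fun_prop) (by fun_prop) (fun z _ => hcoe z)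
      (mem_univ (x, y)) (mem_univ (0, 0))
    simp only [zsmul_eq_mul, mul_one] at hd
    dsimp only at this
    linarith
  refine ⟨H, d, hH, hHφ, ?_, hstep⟩
  rintro rfl
  obtain ⟨K, hK, hKH⟩ := exists_descent_θ hH (by simpa using hstep)
  refine not_exists_lift_of_connected_fibres hsurj (fun t => (hfib t).2.1.isPreconnected) hK ?_
  intro p
  obtain ⟨z, rfl⟩ := isOpenQuotientMap_θ.surjective p
  rw [hKH, hHφ]

/-- A continuous function on the annulus of nonzero vertical degree `d` stays at bounded distance
from `(x, y) ↦ d * y`. -/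
theorem exists_abs_sub_le {H : 𝔸 → ℝ} (hH : Continuous H) {d : ℤ}
    (hstep : ∀ x y, H (x, y + 1) = H (x, y) + d) : ∃ M, ∀ z : 𝔸, |H z - d * z.2| ≤ M := by
  obtain ⟨K, hK, hKH⟩ := exists_descent_θ (H := fun z => H z - d * z.2) (by fun_prop)
    (fun x y => by dsimp only; rw [hstep]; ring)
  obtain ⟨M, hM⟩ := (isCompact_range hK).exists_bound_of_continuousOn continuousOn_id
  exact ⟨M, fun z => by simpa [hKH] using hM _ (mem_range_self (θ z))⟩

/-- The values of a real function on a preconnected set vary by at most `1` if its reduction to the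
circle is not surjective there. -/
theorem abs_sub_le_one_of_coe_ne {X : Type*} [TopologicalSpace X] {S : Set X}
    (hS : IsPreconnected S) {g : X → ℝ} (hg : ContinuousOn g S) {c : ℝ}
    (hc : ∀ x ∈ S, (g x : 𝕊) ≠ c) {x y : X} (hx : x ∈ S) (hy : y ∈ S) : |g x - g y| ≤ 1 := by
  by_contra! hlt
  wlog hxy : g x ≤ g y generalizing x y
  · exact this hy hx (by rwa [abs_sub_comm]) (le_of_not_ge hxy)
  rw [abs_sub_comm, abs_of_nonneg (by linarith)] at hlt
  have : Fact ((0 : ℝ) < 1) := ⟨one_pos⟩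
  obtain ⟨w, hw, hwc⟩ : (c : 𝕊) ∈ ((↑) : ℝ → 𝕊) '' Ico (g x) (g x + 1) := by
    rw [AddCircle.coe_image_Ico_eq]
    trivial
  obtain ⟨v, hv, rfl⟩ := hS.intermediate_value hx hy hg ⟨hw.1, by linarith [hw.2]⟩
  exact hc v hv hwc

/-- Images of a set under iterates commuting with a height function up to translation have bounded
vertical diameter, when the height varies by at most `1` on the set. -/
theorem diam_iterate_le {H : 𝔸 → ℝ} {d : ℤ} (hd : d ≠ 0) {M : ℝ}
    (hM : ∀ z : 𝔸, |H z - d * z.2| ≤ M) {F : 𝔸 → 𝔸} {β : ℝ} (hF : ∀ z, H (F z) = H z + β)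
    {A : Set 𝔸} (hA : ∀ x ∈ A, ∀ y ∈ A, |H x - H y| ≤ 1) (n : ℕ) :
    Metric.diam (Prod.snd '' (F^[n] '' A)) ≤ 1 + 2 * M := by
  have hM0 : 0 ≤ M := (abs_nonneg _).trans (hM 0)
  have hiter : ∀ z, H (F^[n] z) = H z + n * β := by
    intro z
    induction n with
    | zero => simp
    | succ n ih => rw [Function.iterate_succ_apply', hF, ih]; push_cast; ring
  refine diam_le_of_forall_dist_le (by linarith) ?_
  rintro - ⟨-, ⟨x, hx, rfl⟩, rfl⟩ - ⟨-, ⟨y, hy, rfl⟩, rfl⟩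
  have h1 : |H (F^[n] x) - H (F^[n] y)| ≤ 1 := by
    rw [hiter, hiter, add_sub_add_right_eq_sub]
    exact hA x hx y hy
  have h2 : (1 : ℝ) ≤ |(d : ℝ)| := by exact_mod_cast Int.one_le_abs hd
  have h3 : |(d : ℝ)| * |(F^[n] x).2 - (F^[n] y).2| ≤ 1 + 2 * M := by
    rw [← abs_mul]
    have hx' := abs_le.1 (hM (F^[n] x))
    have hy' := abs_le.1 (hM (F^[n] y))
    have h1' := abs_le.1 h1
    exact abs_le.2 ⟨by linarith, by linarith⟩
  rw [Real.dist_eq]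
  exact (le_mul_of_one_le_left (abs_nonneg _) h2).trans h3

theorem diam_image_snd_univ : Metric.diam (Prod.snd '' (univ : Set 𝔸)) = 0 := by
  rw [image_univ, Prod.range_snd]
  refine diam_eq_zero_of_unbounded fun hb => ?_
  exact (not_bddAbove_univ : ¬ BddAbove (univ : Set ℝ)) hb.bddAbove

theorem bounded_vertical_diameter
    (f : 𝕋2 → 𝕋2) (hf : IsHomeomorph f)
    (hhtpy : ContinuousMap.Homotopic ⟨f, hf.continuous⟩ (ContinuousMap.id 𝕋2))
    (h : 𝕋2 → 𝕊) (hh : IsHorizontalMap h)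
    (α : ℝ) (hα : Irrational α)
    (hsemi : ∀ z, h (f z) = h z + (α : 𝕊))
    -- `f̂` is a lift of `f` to the annulus, with inverse `ĝ`:
    (fh : 𝔸 → 𝔸) (hfh : IsHomeomorph fh)
    (gh : 𝔸 → 𝔸) (hgf : Function.LeftInverse gh fh) (hfg : Function.RightInverse gh fh)
    (hlift : ∀ z, θ (fh z) = f (θ z))
    (hT2 : ∀ z : 𝔸, fh (z.1, z.2 + 1) = ((fh z).1, (fh z).2 + 1)) :
    ∃ B > (0:ℝ), ∀ J : Set ℝ, J.OrdConnected →
      ∀ z ∈ θ ⁻¹' (h ⁻¹' ((fun x : ℝ => (x : 𝕊)) '' J)), ∀ n : ℕ,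
        Metric.diam (Prod.snd ''
          (fh^[n] '' connectedComponentIn (θ ⁻¹' (h ⁻¹' ((fun x : ℝ => (x : 𝕊)) '' J))) z)) ≤ B ∧
        Metric.diam (Prod.snd ''
          (gh^[n] '' connectedComponentIn (θ ⁻¹' (h ⁻¹' ((fun x : ℝ => (x : 𝕊)) '' J))) z)) ≤ B := by
  have := connectedSpace_annulus
  obtain ⟨H, d, hH, hHh, hd, hstep⟩ := hh.exists_lift
  obtain ⟨M, hM⟩ := exists_abs_sub_le hH hstep
  have hM0 : 0 ≤ M := (abs_nonneg _).trans (hM 0)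
  obtain ⟨β, hβ⟩ : ∃ β, ∀ z, H (fh z) = H z + β := by
    refine ⟨H (fh 0) - (H 0 + α) + α, fun z => ?_⟩
    have := sub_eq_sub_of_coe_eq (g := fun z => H (fh z)) (g' := fun z => H z + α)
      isPreconnected_univ (hH.comp hfh.continuous).continuousOn (by fun_prop)
      (fun z _ => by rw [hHh, hlift, hsemi, AddCircle.coe_add, hHh]) (mem_univ z) (mem_univ 0)
    linarith
  have hβ' : ∀ z, H (gh z) = H z + -β := by
    intro z
    have := hβ (gh z)
    rw [hfg z] at this
    linarith
  refine ⟨1 + 2 * M, by linarith, fun J _ z hz n => ?_⟩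
  by_cases hJ : ((fun x : ℝ => (x : 𝕊)) '' J) = univ
  · have hf' : fh^[n] '' univ = univ :=
      image_univ_of_surjective (hfg.surjective.iterate n)
    have hg' : gh^[n] '' univ = univ :=
      image_univ_of_surjective (hgf.surjective.iterate n)
    rw [hJ, preimage_univ, preimage_univ, connectedComponentIn_univ,
      PreconnectedSpace.connectedComponent_eq_univ, hf', hg', diam_image_snd_univ]
    constructor <;> linarith
  · obtain ⟨t, ht⟩ := (ne_univ_iff_exists_notMem _).1 hJ
    obtain ⟨c, rfl⟩ := isOpenQuotientMap_coe_circle.surjective t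
    have hA : ∀ x ∈ connectedComponentIn (θ ⁻¹' (h ⁻¹' ((fun x : ℝ => (x : 𝕊)) '' J))) z,
        ∀ y ∈ connectedComponentIn (θ ⁻¹' (h ⁻¹' ((fun x : ℝ => (x : 𝕊)) '' J))) z,
        |H x - H y| ≤ 1 := fun x hx y hy =>
      abs_sub_le_one_of_coe_ne isPreconnected_connectedComponentIn hH.continuousOn
        (fun w hw hwc => ht (by
          rw [← hwc, hHh]
          exact (connectedComponentIn_subset
            (θ ⁻¹' (h ⁻¹' ((fun x : ℝ => (x : 𝕊)) '' J))) z) hw)) hx hy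
    exact ⟨diam_iterate_le hd hM hβ hA n, diam_iterate_le hd hM hβ' hA n⟩
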